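/- arXiv:0709.4112 — 9 statements merged into one kernel-verified Lean document; each statement's English description precedes it below -/
import Mathlib

section
/- Let n > 2 and s > 1 be coprime integers and let t be the multiplicative order of n modulo s. Let A be a commutative ring equipped with a ℤ/nℤ-algebra structure such that for every prime r dividing n the image of r in A is not a unit. Suppose α is a unit of A with Φ_s(α) = 0 in A, and that every coefficient of the polynomial Ψ(X) = ∏_{i=1}^{t} (X − α^{n^i}) ∈ A[X] lies in the image of the structure map ℤ/nℤ → A. Then every divisor r of n satisfies r ≡ n^i (mod s) for some 1 ≤ i ≤ t. -/
open Polynomial in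
theorem prime_case (n s : ℕ) (hn : 2 < n) (hs : 1 < s) (hcop : Nat.Coprime n s)
    (t : ℕ) (ht : t = orderOf (n : ZMod s)) (htpos : 0 < t)
    (A : Type*) [CommRing A] [Algebra (ZMod n) A]
    (hnonunit : ∀ r : ℕ, r.Prime → r ∣ n → ¬ IsUnit ((r : A)))
    (α : A)
    (hΦ : Polynomial.eval α (Polynomial.cyclotomic s A) = 0)
    (hΨ : ∀ j : ℕ,
      (∏ i ∈ Finset.range t, (Polynomial.X - Polynomial.C (α ^ n ^ (i + 1)))).coeff j
        ∈ Set.range (algebraMap (ZMod n) A))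
    (r : ℕ) (hr : r.Prime) (hrn : r ∣ n) : ∃ i : ℕ, (r : ZMod s) = (n : ZMod s) ^ i := by
  haveI : NeZero n := ⟨by omega⟩
  haveI : Fact r.Prime := ⟨hr⟩
  obtain ⟨M, hM, hrM⟩ := exists_max_ideal_of_mem_nonunits (hnonunit r hr hrn)
  letI : Field (A ⧸ M) := Ideal.Quotient.field M
  let f : A →+* A ⧸ M := Ideal.Quotient.mk M
  have hr0 : ((r : ℕ) : A ⧸ M) = 0 := by
    have : f (r : A) = 0 := Ideal.Quotient.eq_zero_iff_mem.mpr hrM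
    simpa using this
  haveI : CharP (A ⧸ M) r := by
    have h := ringChar.dvd hr0
    rcases (Nat.dvd_prime hr).mp h with h | h
    · exact absurd h CharP.ringChar_ne_one
    · exact (ringChar.eq_iff).mp h
  have hs0 : NeZero ((s : ℕ) : A ⧸ M) := by
    constructor
    rw [Ne, CharP.cast_eq_zero_iff (A ⧸ M) r s]
    intro h
    have := Nat.dvd_gcd hrn h
    rw [hcop] at this
    exact hr.one_lt.ne' (Nat.dvd_one.mp this)
  have hprim : IsPrimitiveRoot (f α) s := by
    rw [← isRoot_cyclotomic_iff, IsRoot.def, ← map_cyclotomic s f, eval_map_apply, hΦ, map_zero]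
  set Q : (A ⧸ M)[X] := (∏ i ∈ Finset.range t, (X - C (α ^ n ^ (i + 1)))).map f with hQ
  have hQF : Q.map (frobenius (A ⧸ M) r) = Q := by
    ext j
    obtain ⟨z, hz⟩ := hΨ j
    rw [coeff_map, hQ, coeff_map, ← hz, ← ZMod.natCast_zmod_val z, map_natCast, map_natCast,
      map_natCast]
  have hQe : ∀ x, Q.eval x = ∏ i ∈ Finset.range t, (x - (f α) ^ n ^ (i + 1)) := by
    intro x
    simp [hQ, Polynomial.map_prod, eval_prod]
  have hpow : ∀ a b : ℕ, (f α) ^ a = (f α) ^ b ↔ (a : ZMod s) = b := by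
    intro a b
    rw [ZMod.natCast_eq_natCast_iff, hprim.eq_orderOf]
    exact (isOfFinOrder_iff_pow_eq_one.mpr ⟨s, by omega, hprim.pow_eq_one⟩).pow_eq_pow_iff_modEq
  have hroot : Q.eval (f α) = 0 := by
    rw [hQe]
    apply Finset.prod_eq_zero (i := t - 1) (by simp; omega)
    rw [sub_eq_zero]
    nth_rewrite 1 [← pow_one (f α)]
    rw [hpow, Nat.sub_add_cancel htpos]
    push_cast
    rw [ht, pow_orderOf_eq_one]
  have h2 : Q.eval (f α ^ r) = 0 := by
    rw [← frobenius_def, ← hQF, eval_map_apply, hroot, map_zero]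
  rw [hQe, Finset.prod_eq_zero_iff] at h2
  obtain ⟨i, -, hi⟩ := h2
  rw [sub_eq_zero, hpow] at hi
  exact ⟨i + 1, by exact_mod_cast hi⟩

theorem stmt_0 (n s : ℕ) (hn : 2 < n) (hs : 1 < s) (hcop : Nat.Coprime n s)
    (t : ℕ) (ht : t = orderOf (n : ZMod s))
    (A : Type*) [CommRing A] [Algebra (ZMod n) A]
    (hnonunit : ∀ r : ℕ, r.Prime → r ∣ n → ¬ IsUnit ((r : A)))
    (α : A) (hα : IsUnit α)
    (hΦ : Polynomial.eval α (Polynomial.cyclotomic s A) = 0)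
    (hΨ : ∀ j : ℕ,
      (∏ i ∈ Finset.range t, (Polynomial.X - Polynomial.C (α ^ n ^ (i + 1)))).coeff j
        ∈ Set.range (algebraMap (ZMod n) A)) :
    ∀ r : ℕ, r ∣ n → ∃ i : ℕ, 1 ≤ i ∧ i ≤ t ∧ (r : ZMod s) = (n : ZMod s) ^ i := by
  haveI : NeZero s := ⟨by omega⟩
  have htpos : 0 < t := by
    rw [ht, ← ZMod.coe_unitOfCoprime n hcop, orderOf_units]
    exact orderOf_pos _
  have key : ∀ r : ℕ, r ∣ n → ∃ i : ℕ, (r : ZMod s) = (n : ZMod s) ^ i := by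
    intro r
    induction r using Nat.recOnMul with
    | zero => intro h; rw [zero_dvd_iff] at h; omega
    | one => intro _; exact ⟨0, by simp⟩
    | prime p hp =>
      intro h
      exact prime_case n s hn hs hcop t ht htpos A hnonunit α hΦ hΨ p hp h
    | mul a b iha ihb =>
      intro h
      obtain ⟨i, hi⟩ := iha (dvd_of_mul_right_dvd h)
      obtain ⟨j, hj⟩ := ihb (dvd_of_mul_left_dvd h)
      exact ⟨i + j, by rw [pow_add, Nat.cast_mul, hi, hj]⟩
  intro r hr
  obtain ⟨i, hi⟩ := key r hr
  have hmod : (n : ZMod s) ^ (i % t) = (n : ZMod s) ^ i := by rw [ht, pow_mod_orderOf]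
  have hlt := Nat.mod_lt i htpos
  by_cases h0 : i % t = 0
  · refine ⟨t, htpos, le_rfl, ?_⟩
    rw [hi, ← hmod, h0, pow_zero, ht, pow_orderOf_eq_one]
  · exact ⟨i % t, by omega, hlt.le, by rw [hi, hmod]⟩
end

section
/- Let A be a commutative ring and R a commutative A-algebra. Let G be a finite group acting on R by A-algebra automorphisms such that the image of |G| in A is a unit. Suppose there is ρ ∈ R such that the family (σ(ρ))_{σ ∈ G} spans R as an A-module, and such that the trace ∑_{σ ∈ G} σ(ρ) lies in the image of the structure map A → R. Then every element α ∈ R fixed by every element of G lies in the image of the structure map A → R. -/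
theorem stmt_1 (A : Type*) [CommRing A] (R : Type*) [CommRing R] [Algebra A R]
    (G : Type*) [Group G] [Fintype G] (φ : G →* (R ≃ₐ[A] R))
    (hcard : IsUnit ((Fintype.card G : A)))
    (ρ : R) (hspan : Submodule.span A (Set.range fun σ : G => φ σ ρ) = ⊤)
    (htrace : (∑ σ : G, φ σ ρ) ∈ Set.range (algebraMap A R)) :
    ∀ α : R, (∀ σ : G, φ σ α = α) → α ∈ Set.range (algebraMap A R) := by
  have key : ∀ x : R, (∑ σ : G, φ σ x) ∈ Set.range (algebraMap A R) := by
    intro x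
    have hx : x ∈ Submodule.span A (Set.range fun σ : G => φ σ ρ) := by
      rw [hspan]; trivial
    induction hx using Submodule.span_induction with
    | mem y hy =>
      obtain ⟨τ, rfl⟩ := hy
      have : (∑ σ : G, φ σ (φ τ ρ)) = ∑ σ : G, φ σ ρ := by
        rw [← Equiv.sum_comp (Equiv.mulRight τ) (fun σ => φ σ ρ)]
        simp [map_mul]
      simpa only [this] using htrace
    | zero => exact ⟨0, by simp⟩
    | add y z _ _ hy hz =>
      obtain ⟨a, ha⟩ := hy
      obtain ⟨b, hb⟩ := hz
      exact ⟨a + b, by simp [ha, hb, Finset.sum_add_distrib]⟩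
    | smul c y _ hy =>
      obtain ⟨a, ha⟩ := hy
      exact ⟨c * a, by rw [map_mul, ha, ← Algebra.smul_def]; simp [Finset.smul_sum]⟩
  intro α hα
  obtain ⟨a, ha⟩ := key α
  obtain ⟨b, hb⟩ := hcard.exists_left_inv
  refine ⟨b * a, ?_⟩
  have h2 : algebraMap A R a = algebraMap A R (Fintype.card G : A) * α := by
    rw [ha]; simp [hα]
  rw [map_mul, h2, ← mul_assoc, ← map_mul, hb, map_one, one_mul]
end

section
/- Let n > 1 be an integer and q a prime dividing n − 1 with q² > n. Suppose a is an integer with a^{n−1} ≡ 1 (mod n) and gcd(a^{(n−1)/q} − 1, n) = 1. Then n is prime. -/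
theorem stmt_6 (n : ℕ) (hn : 1 < n) (q : ℕ) (hq : q.Prime) (hdvd : q ∣ n - 1)
    (hq2 : n < q ^ 2) (a : ℤ)
    (hfermat : a ^ (n - 1) ≡ 1 [ZMOD n])
    (hgcd : Int.gcd (a ^ ((n - 1) / q) - 1) n = 1) :
    Nat.Prime n := by
  by_contra hnp
  have hp : n.minFac.Prime := Nat.minFac_prime (by omega)
  have hle : n.minFac ^ 2 ≤ n := Nat.minFac_sq_le_self (by omega) hnp
  have hpn : n.minFac ∣ n := Nat.minFac_dvd n
  generalize n.minFac = p at hp hle hpn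
  haveI : Fact p.Prime := ⟨hp⟩
  haveI : Fact q.Prime := ⟨hq⟩
  have hpz : (p : ℤ) ∣ (n : ℤ) := by exact_mod_cast hpn
  have h1 : (a : ZMod p) ^ (n - 1) = 1 := by
    have h := (ZMod.intCast_eq_intCast_iff (a ^ (n - 1)) 1 p).2 (hfermat.of_dvd hpz)
    exact_mod_cast h
  have hbq : ((a : ZMod p) ^ ((n - 1) / q)) ^ q = 1 := by
    rw [← pow_mul, Nat.div_mul_cancel hdvd, h1]
  have hb1 : (a : ZMod p) ^ ((n - 1) / q) ≠ 1 := by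
    intro h
    have h2 : (p : ℤ) ∣ a ^ ((n - 1) / q) - 1 := by
      rw [← ZMod.intCast_zmod_eq_zero_iff_dvd]
      push_cast
      rw [h, sub_self]
    have h3 := Int.dvd_coe_gcd h2 hpz
    rw [hgcd] at h3
    exact hp.one_lt.ne' (Nat.dvd_one.1 (by exact_mod_cast h3))
  have ho := orderOf_eq_prime hbq hb1
  have hb0 : (a : ZMod p) ^ ((n - 1) / q) ≠ 0 := by
    intro h
    rw [h, zero_pow hq.ne_zero] at hbq
    exact zero_ne_one hbq
  have hd : q ∣ p - 1 := by
    rw [← ho]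
    exact orderOf_dvd_of_pow_eq_one (ZMod.pow_card_sub_one_eq_one hb0)
  have hlt := Nat.le_of_dvd (by have := hp.one_lt; omega) hd
  have : q ^ 2 ≤ p ^ 2 := Nat.pow_le_pow_left (by omega) 2
  omega
end

section
/- Let p be an odd prime and N ≥ 2 an integer with N ≡ 1 (mod p), and set u = v_p(N − 1). Then for every natural number j, the product p^j·(N − 1) divides N^{p^j} − 1, and the quotient (N^{p^j} − 1)/(p^j·(N − 1)) is congruent to 1 modulo p^u. -/
theorem aux_binom (d n : ℕ) :
    ∃ c, (1 + d) ^ n = 1 + n * d + n.choose 2 * d ^ 2 + d ^ 3 * c := by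
  induction n with
  | zero => exact ⟨0, by simp⟩
  | succ n ih =>
    obtain ⟨c, hc⟩ := ih
    refine ⟨n.choose 2 + c + d * c, ?_⟩
    have h : (n + 1).choose 2 = n + n.choose 2 := by
      rw [Nat.choose_succ_succ' n 1, Nat.choose_one_right]
    rw [pow_succ, hc, h]
    push_cast
    ring

theorem aux_step (p k f D e : ℕ) (hk : p = 2 * k + 1) (hD : D = p * f) :
    ∃ t, (1 + D * e) ^ p = 1 + D * e * p * (1 + D * t) := by
  obtain ⟨c, hc⟩ := aux_binom (D * e) p
  have h : p.choose 2 = p * k := by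
    rw [Nat.choose_two_right, hk]
    have : (2 * k + 1) * (2 * k + 1 - 1) = (2 * k + 1) * k * 2 := by
      rw [Nat.add_sub_cancel]; ring
    rw [this]; simp
  refine ⟨k * e + f * e ^ 2 * c, ?_⟩
  rw [hc, h]
  clear hc h hk
  subst hD
  ring

theorem stmt_8 (p : ℕ) (hp : p.Prime) (hodd : Odd p) (N : ℕ) (hN : 2 ≤ N)
    (hmod : N ≡ 1 [MOD p]) (u : ℕ) (hu : u = padicValNat p (N - 1)) :
    ∀ j : ℕ, p ^ j * (N - 1) ∣ N ^ p ^ j - 1 ∧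
      (N ^ p ^ j - 1) / (p ^ j * (N - 1)) ≡ 1 [MOD p ^ u] := by
  haveI := Fact.mk hp
  obtain ⟨k, hk⟩ := hodd
  have hpd : p ∣ N - 1 := (Nat.modEq_iff_dvd' (by omega)).1 hmod.symm
  have hu1 : 1 ≤ u := by
    rw [hu]
    exact one_le_padicValNat_of_dvd (by omega) hpd
  obtain ⟨f, hf⟩ : p ∣ p ^ u := dvd_pow_self p (by omega)
  obtain ⟨m, hm⟩ : p ^ u ∣ N - 1 := by rw [hu]; exact pow_padicValNat_dvd
  have key : ∀ j : ℕ, ∃ t, N ^ p ^ j = 1 + p ^ j * (N - 1) * (1 + p ^ u * t) := by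
    intro j
    induction j with
    | zero => exact ⟨0, by simp; omega⟩
    | succ j ih =>
      obtain ⟨t, ht⟩ := ih
      obtain ⟨s, hs⟩ := aux_step p k f (p ^ u) (p ^ j * m * (1 + p ^ u * t)) hk hf
      refine ⟨t + s + p ^ u * t * s, ?_⟩
      have e : 1 + p ^ j * (N - 1) * (1 + p ^ u * t)
          = 1 + p ^ u * (p ^ j * m * (1 + p ^ u * t)) := by rw [hm]; ring
      rw [pow_succ, pow_mul, ht, e, hs, hm]
      ring
  intro j
  obtain ⟨t, ht⟩ := key j
  have hpos : 0 < p ^ j * (N - 1) := Nat.mul_pos (pow_pos hp.pos j) (by omega)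
  rw [ht, Nat.add_sub_cancel_left, Nat.mul_div_cancel_left _ hpos]
  refine ⟨dvd_mul_right _ _, ?_⟩
  simp [Nat.ModEq]
end

section
/- Let n > 1 and s > 1 be coprime integers and let t be the multiplicative order of n modulo s. Suppose Ψ is a monic polynomial of degree t over ℤ/nℤ that divides the image of Φ_s in (ℤ/nℤ)[X], and suppose that in the quotient ring R = (ℤ/nℤ)[X]/(Ψ), writing ζ for the image of X, one has Ψ(ζ^{n^i}) = 0 for every i = 1, …, t. Then every divisor r of n satisfies r ≡ n^i (mod s) for some 1 ≤ i ≤ t. -/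
theorem prime_case_s9 (n s : ℕ) (hn : 1 < n) (hs : 1 < s)
    (t : ℕ) (u : (ZMod s)ˣ) (hu : (u : ZMod s) = n) (hcop : Nat.Coprime n s)
    (ht : t = orderOf u) (htpos : 0 < t)
    (Ψ : Polynomial (ZMod n)) (hmonic : Ψ.Monic) (hdeg : Ψ.natDegree = t)
    (hdvd : Ψ ∣ Polynomial.cyclotomic s (ZMod n))
    (hroots : ∀ i : ℕ, 1 ≤ i → i ≤ t →
      Polynomial.aeval ((AdjoinRoot.root Ψ) ^ n ^ i) Ψ = 0)
    (p : ℕ) (hp : p.Prime) (hpn : p ∣ n) :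
    ∃ i : ℕ, 1 ≤ i ∧ i ≤ t ∧ (p : ZMod s) = (n : ZMod s) ^ i := by
  classical
  have : Fact p.Prime := ⟨hp⟩
  let K := AlgebraicClosure (ZMod p)
  have : CharP K p := charP_of_injective_algebraMap (algebraMap (ZMod p) K).injective p
  let f : ZMod n →+* K := (algebraMap (ZMod p) K).comp (ZMod.castHom hpn (ZMod p))
  have hps : p.Coprime s := Nat.Coprime.coprime_dvd_left hpn hcop
  have hsK : NeZero (s : K) := ⟨by
    rw [Ne, CharP.cast_eq_zero_iff K p]
    exact (Nat.Prime.coprime_iff_not_dvd hp).1 hps⟩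
  have hm : (Ψ.map f).Monic := hmonic.map f
  have hd : (Ψ.map f).natDegree = t := by rw [hmonic.natDegree_map, hdeg]
  obtain ⟨z, hz⟩ := IsAlgClosed.exists_root (Ψ.map f) (by
    intro h
    have : (Ψ.map f).natDegree = 0 := Polynomial.natDegree_eq_of_degree_eq_some h
    omega)
  have hz0 : Ψ.eval₂ f z = 0 := by rwa [Polynomial.IsRoot, Polynomial.eval_map] at hz
  have hprim : IsPrimitiveRoot z s := by
    rw [← Polynomial.isRoot_cyclotomic_iff, ← Polynomial.map_cyclotomic s f]
    exact hz.dvd (Polynomial.map_dvd f hdvd)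
  have hmod : ∀ a b : ℕ, z ^ a = z ^ b ↔ (a : ZMod s) = b := by
    intro a b
    rw [ZMod.natCast_eq_natCast_iff, hprim.eq_orderOf]
    obtain ⟨w, rfl⟩ := hprim.isUnit (by omega)
    rw [orderOf_units, ← pow_eq_pow_iff_modEq, ← Units.val_pow_eq_pow_val,
      ← Units.val_pow_eq_pow_val, Units.val_inj]
  have hfz : ∀ i, 1 ≤ i → i ≤ t → Ψ.eval₂ f (z ^ n ^ i) = 0 := by
    intro i h1 h2
    have := congrArg (AdjoinRoot.lift f z hz0) (hroots i h1 h2)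
    rw [Polynomial.aeval_def, Polynomial.hom_eval₂, map_pow, AdjoinRoot.lift_root, map_zero] at this
    convert this using 2
    exact Subsingleton.elim _ _
  have hfp : Ψ.eval₂ f (z ^ p) = 0 := by
    have := congrArg (frobenius K p) hz0
    rw [Polynomial.hom_eval₂, map_zero, frobenius_def] at this
    convert this using 2
    exact Subsingleton.elim _ _
  let S := (Finset.Icc 1 t).image (fun i => z ^ n ^ i)
  have hS : S.card = t := by
    rw [Finset.card_image_of_injOn, Nat.card_Icc]; · omega
    intro i hi j hj hij
    simp only [Finset.coe_Icc, Set.mem_Icc] at hi hj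
    have h := (hmod _ _).1 hij
    push_cast at h
    rw [← hu] at h
    have h' : u ^ i = u ^ j := Units.ext (by push_cast; exact h)
    rw [pow_eq_pow_iff_modEq, ← ht] at h'
    rcases hi with ⟨hi1, hi2⟩
    rcases hj with ⟨hj1, hj2⟩
    have h2 : i - 1 ≡ j - 1 [MOD t] := by
      apply Nat.ModEq.add_right_cancel' 1
      rwa [Nat.sub_add_cancel hi1, Nat.sub_add_cancel hj1]
    have := h2.eq_of_lt_of_lt (by omega) (by omega)
    omega
  have hsub : S ⊆ (Ψ.map f).roots.toFinset := by
    intro x hx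
    obtain ⟨i, hi, rfl⟩ := Finset.mem_image.1 hx
    rw [Finset.mem_Icc] at hi
    rw [Multiset.mem_toFinset, Polynomial.mem_roots hm.ne_zero, Polynomial.IsRoot,
      Polynomial.eval_map]
    exact hfz i hi.1 hi.2
  have heq := Finset.eq_of_subset_of_card_le hsub (by
    rw [hS, ← hd]
    exact (Multiset.toFinset_card_le _).trans (Polynomial.card_roots' _))
  have hmem : z ^ p ∈ S := by
    rw [heq, Multiset.mem_toFinset, Polynomial.mem_roots hm.ne_zero, Polynomial.IsRoot,
      Polynomial.eval_map]
    exact hfp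
  obtain ⟨i, hi, h⟩ := Finset.mem_image.1 hmem
  rw [Finset.mem_Icc] at hi
  refine ⟨i, hi.1, hi.2, ?_⟩
  have := (hmod _ _).1 h.symm
  push_cast at this
  exact this


theorem stmt_9 (n s : ℕ) (hn : 1 < n) (hs : 1 < s) (hcop : Nat.Coprime n s)
    (t : ℕ) (ht : t = orderOf (n : ZMod s))
    (Ψ : Polynomial (ZMod n)) (hmonic : Ψ.Monic) (hdeg : Ψ.natDegree = t)
    (hdvd : Ψ ∣ Polynomial.cyclotomic s (ZMod n))
    (hroots : ∀ i : ℕ, 1 ≤ i → i ≤ t →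
      Polynomial.aeval ((AdjoinRoot.root Ψ) ^ n ^ i) Ψ = 0) :
    ∀ r : ℕ, r ∣ n → ∃ i : ℕ, 1 ≤ i ∧ i ≤ t ∧ (r : ZMod s) = (n : ZMod s) ^ i := by
  have : NeZero s := ⟨by omega⟩
  let u := ZMod.unitOfCoprime n hcop
  have hu : (u : ZMod s) = n := ZMod.coe_unitOfCoprime n hcop
  have ht' : t = orderOf u := by rw [ht, ← hu, orderOf_units]
  have htpos : 0 < t := ht' ▸ orderOf_pos u
  have hpow : ∀ k : ℕ, ∃ i : ℕ, 1 ≤ i ∧ i ≤ t ∧ (n : ZMod s) ^ k = (n : ZMod s) ^ i := by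
    intro k
    have hk := Nat.mod_lt k htpos
    have hmodk : (n : ZMod s) ^ (k % t) = (n : ZMod s) ^ k := by rw [ht, pow_mod_orderOf]
    rcases Nat.eq_zero_or_pos (k % t) with h0 | h0
    · refine ⟨t, htpos, le_rfl, ?_⟩
      rw [← hmodk, h0, pow_zero, ht, pow_orderOf_eq_one]
    · exact ⟨k % t, h0, hk.le, hmodk.symm⟩
  intro r
  induction r using Nat.recOnMul with
  | zero =>
    intro h
    have := Nat.eq_zero_of_zero_dvd h
    omega
  | one =>
    intro _
    simpa using hpow 0
  | prime p hp =>
    intro h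
    exact prime_case_s9 n s hn hs t u hu hcop ht' htpos Ψ hmonic hdeg hdvd hroots p hp h
  | mul a b iha ihb =>
    intro h
    obtain ⟨i, -, -, hi⟩ := iha (dvd_of_mul_right_dvd h)
    obtain ⟨j, -, -, hj⟩ := ihb (dvd_of_mul_left_dvd h)
    obtain ⟨k, h1, h2, h3⟩ := hpow (i + j)
    refine ⟨k, h1, h2, ?_⟩
    rw [← h3, pow_add, ← hi, ← hj]
    push_cast
    rfl
end

section
/- Let n > 1 and s > 1 be integers with gcd(n, s) = 1, let t be the multiplicative order of n modulo s, and assume gcd(n, t) = 1. Let σ_n be the ℚ-automorphism of the s-th cyclotomic field ℚ(ζ_s) determined by ζ_s ↦ ζ_s^n, and let L be the fixed field of the cyclic subgroup of the Galois group generated by σ_n. If every prime divisor r of n satisfies r ≡ n^i (mod s) for some natural number i, then there exists a surjective ring homomorphism from the ring of integers of L onto ℤ/nℤ. -/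
theorem aux_pow_le {R : Type*} [CommRing R] (P : Ideal R) (r : R) (hr : r ∈ P)
    (h : P ≤ P ^ 2 ⊔ Ideal.span {r}) (m : ℕ) :
    P ^ m ≤ P ^ (m + 1) ⊔ Ideal.span {r ^ m} := by
  induction m with
  | zero => simp
  | succ m ih =>
    have hrm : Ideal.span {r ^ m} ≤ P ^ m := by
      rw [Ideal.span_singleton_le_iff_mem]
      exact Ideal.pow_mem_pow hr m
    have hr' : Ideal.span {r} ≤ P := by
      rwa [Ideal.span_singleton_le_iff_mem]
    calc P ^ (m + 1) = P ^ m * P := pow_succ _ _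
      _ ≤ (P ^ (m + 1) ⊔ Ideal.span {r ^ m}) * (P ^ 2 ⊔ Ideal.span {r}) := Ideal.mul_mono ih h
      _ ≤ P ^ (m + 1 + 1) ⊔ Ideal.span {r ^ (m + 1)} := by
        rw [Ideal.sup_mul, Ideal.mul_sup, Ideal.mul_sup]
        refine sup_le (sup_le ?_ ?_) (sup_le ?_ ?_)
        · refine le_trans ?_ le_sup_left
          rw [← pow_add]
          exact Ideal.pow_le_pow_right (by omega)
        · refine le_trans ?_ le_sup_left
          rw [pow_succ P (m + 1)]
          exact Ideal.mul_mono le_rfl hr'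
        · refine le_trans ?_ le_sup_left
          refine (Ideal.mul_mono hrm le_rfl).trans ?_
          rw [← pow_add]
        · refine le_trans ?_ le_sup_right
          rw [Ideal.span_singleton_mul_span_singleton, ← pow_succ]

theorem aux_local {R : Type*} [CommRing R] [IsDedekindDomain R] [CharZero R] (r : ℕ)
    (hrp : r.Prime) (hu : ¬ IsUnit (r : R)) (hx : ∀ x : R, (r : R) ∣ x ^ r - x) (k : ℕ)
    (hk : 0 < k) : Nonempty (R →+* ZMod (r ^ k)) := by
  have : Fact r.Prime := ⟨hrp⟩
  obtain ⟨P, hP, hrP⟩ := exists_max_ideal_of_mem_nonunits hu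
  have hP0 : P ≠ ⊥ := by
    rintro rfl
    rw [Ideal.mem_bot] at hrP
    exact hrp.ne_zero (by exact_mod_cast hrP)
  have h : P ≤ P ^ 2 ⊔ Ideal.span {(r : R)} := by
    intro x hxP
    have : x = x ^ r - (x ^ r - x) := by ring
    rw [this]
    refine Ideal.sub_mem _ (Ideal.mem_sup_left ?_) (Ideal.mem_sup_right ?_)
    · exact Ideal.pow_le_pow_right hrp.two_le (Ideal.pow_mem_pow hxP r)
    · exact Ideal.mem_span_singleton.2 (hx x)
  have hA := aux_pow_le P (r : R) hrP h
  -- residue field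
  have h1 : ∀ x : R, ∃ a : ℤ, x - a ∈ P := by
    intro x
    let _ : Field (R ⧸ P) := Ideal.Quotient.field P
    have : CharP (R ⧸ P) r := by
      rw [CharP.charP_iff_prime_eq_zero hrp, ← map_natCast (Ideal.Quotient.mk P)]
      exact Ideal.Quotient.eq_zero_iff_mem.2 hrP
    have hb : Ideal.Quotient.mk P x ∈ (⊥ : Subfield (R ⧸ P)) := by
      rw [Subfield.mem_bot_iff_pow_eq_self (R ⧸ P) r, ← map_pow, Ideal.Quotient.mk_eq_mk_iff_sub_mem]
      exact P.mem_of_dvd (hx x) hrP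
    rw [_root_.mem_bot_iff_intCast r] at hb
    obtain ⟨a, ha⟩ := hb
    refine ⟨a, ?_⟩
    rw [← Ideal.Quotient.mk_eq_mk_iff_sub_mem, map_intCast, ha]
  have h2 : ∀ (m : ℕ) (x : R), ∃ a : ℤ, x - a ∈ P ^ m := by
    intro m
    induction m with
    | zero => simp
    | succ m ih =>
      intro x
      obtain ⟨a, ha⟩ := ih x
      obtain ⟨y, hy, w, hw, hyw⟩ := Submodule.mem_sup.1 (hA m ha)
      obtain ⟨z, rfl⟩ := Ideal.mem_span_singleton.1 hw
      obtain ⟨b, hb⟩ := h1 z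
      refine ⟨a + r ^ m * b, ?_⟩
      have : x - ((a + r ^ m * b : ℤ) : R) = y + (r : R) ^ m * (z - b) := by
        push_cast
        linear_combination -hyw
      rw [this]
      refine Ideal.add_mem _ hy ?_
      rw [pow_succ P m]
      exact Ideal.mul_mem_mul (Ideal.pow_mem_pow hrP m) hb
  obtain ⟨m, rfl⟩ : ∃ m, k = m + 1 := ⟨k - 1, by omega⟩
  have h3 : (r : R) ^ m ∉ P ^ (m + 1) := by
    intro hmem
    have : P ^ m ≤ P ^ (m + 1) :=
      (hA m).trans (sup_le le_rfl ((Ideal.span_singleton_le_iff_mem _).2 hmem))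
    exact absurd this (not_le_of_gt (Ideal.pow_right_strictAnti P hP0 hP.ne_top m.lt_succ_self))
  have h4 : (r : R) ^ (m + 1) ∈ P ^ (m + 1) := Ideal.pow_mem_pow hrP _
  have : CharP (R ⧸ P ^ (m + 1)) (r ^ (m + 1)) := by
    obtain ⟨c, hc⟩ := CharP.exists (R ⧸ P ^ (m + 1))
    have hd : c ∣ r ^ (m + 1) := by
      rw [← CharP.cast_eq_zero_iff (R ⧸ P ^ (m + 1)) c]
      have := Ideal.Quotient.eq_zero_iff_mem.2 h4
      simpa using this
    obtain ⟨j, hj, rfl⟩ := (Nat.dvd_prime_pow hrp).1 hd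
    have : j = m + 1 := by
      by_contra hne
      apply h3
      rw [← Ideal.Quotient.eq_zero_iff_mem]
      have := (CharP.cast_eq_zero_iff (R ⧸ P ^ (m + 1)) (r ^ j) (r ^ m)).2
        (pow_dvd_pow r (by omega))
      simpa using this
    subst this
    exact hc
  have hbij : Function.Bijective (ZMod.castHom (dvd_refl (r ^ (m + 1))) (R ⧸ P ^ (m + 1))) := by
    refine ⟨ZMod.castHom_injective _, ?_⟩
    intro q
    obtain ⟨x, rfl⟩ := Ideal.Quotient.mk_surjective q
    obtain ⟨a, ha⟩ := h2 (m + 1) x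
    refine ⟨(a : ZMod _), ?_⟩
    rw [map_intCast, ← map_intCast (Ideal.Quotient.mk (P ^ (m + 1))), eq_comm,
      Ideal.Quotient.mk_eq_mk_iff_sub_mem]
    exact ha
  exact ⟨((RingEquiv.ofBijective _ hbij).symm.toRingHom).comp (Ideal.Quotient.mk (P ^ (m + 1)))⟩

theorem aux_global {R : Type*} [CommRing R] [IsDedekindDomain R] [CharZero R] (n : ℕ)
    (hn : n ≠ 0) (h : ∀ r : ℕ, r.Prime → r ∣ n →
      ¬ IsUnit (r : R) ∧ ∀ x : R, (r : R) ∣ x ^ r - x) : Nonempty (R →+* ZMod n) := by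
  induction n using Nat.recOnPosPrimePosCoprime with
  | prime_pow p k hp hk =>
    have := h p hp (dvd_pow_self p hk.ne')
    exact aux_local p hp this.1 this.2 k hk
  | zero => exact absurd rfl hn
  | one => exact ⟨⟨⟨⟨fun _ => 0, Subsingleton.elim _ _⟩, fun _ _ => Subsingleton.elim _ _⟩,
      Subsingleton.elim _ _, fun _ _ => Subsingleton.elim _ _⟩⟩
  | coprime a b ha hb hab iha ihb =>
    obtain ⟨f⟩ := iha (by omega) fun r hr hd => h r hr (hd.mul_right b)
    obtain ⟨g⟩ := ihb (by omega) fun r hr hd => h r hr (hd.mul_left a)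
    exact ⟨((ZMod.chineseRemainder hab).symm.toRingHom).comp (f.prod g)⟩

theorem aux_frob {K : Type*} [Field K] [NumberField K] (s : ℕ) [NeZero s]
    [IsCyclotomicExtension {s} ℚ K] (ζ : K) (hζ : IsPrimitiveRoot ζ s) (r : ℕ) (hr : r.Prime)
    (τ : K →+* K) (hτ : τ ζ = ζ ^ r) (x : K) (hx : IsIntegral ℤ x) :
    ∃ z : K, IsIntegral ℤ z ∧ x ^ r - τ x = r * z := by
  have : Fact r.Prime := ⟨hr⟩
  have hmem : x ∈ Algebra.adjoin ℤ ({ζ} : Set K) := by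
    have := IsCyclotomicExtension.Rat.isIntegralClosure_adjoin_singleton (n := s) hζ
    obtain ⟨y, rfl⟩ := this.isIntegral_iff.1 hx
    exact y.2
  have hint : ∀ y ∈ Algebra.adjoin ℤ ({ζ} : Set K), IsIntegral ℤ y := by
    intro y hy
    have hle : Algebra.adjoin ℤ ({ζ} : Set K) ≤ integralClosure ℤ K := by
      rw [Algebra.adjoin_le_iff, Set.singleton_subset_iff]
      exact hζ.isIntegral (NeZero.pos s)
    exact hle hy
  suffices ∃ z : K, z ∈ Algebra.adjoin ℤ ({ζ} : Set K) ∧ x ^ r - τ x = r * z by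
    obtain ⟨z, hz, h⟩ := this
    exact ⟨z, hint z hz, h⟩
  clear hx
  have hτmem : ∀ y ∈ Algebra.adjoin ℤ ({ζ} : Set K), τ y ∈ Algebra.adjoin ℤ ({ζ} : Set K) := by
    intro y hy
    induction hy using Algebra.adjoin_induction with
    | mem y hy =>
      rw [Set.mem_singleton_iff.1 hy, hτ]
      exact pow_mem (Algebra.subset_adjoin (Set.mem_singleton ζ)) _
    | algebraMap a => simp
    | add a b _ _ ha hb => rw [map_add]; exact add_mem ha hb
    | mul a b _ _ ha hb => rw [map_mul]; exact mul_mem ha hb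
  induction hmem using Algebra.adjoin_induction with
  | mem y hy =>
    refine ⟨0, zero_mem _, ?_⟩
    rw [Set.mem_singleton_iff.1 hy, hτ]; simp
  | algebraMap a =>
    have hd : (r : ℤ) ∣ a ^ r - a := by
      rw [← ZMod.intCast_zmod_eq_zero_iff_dvd]
      push_cast
      rw [ZMod.pow_card, sub_self]
    obtain ⟨c, hc⟩ := hd
    refine ⟨c, intCast_mem _ c, ?_⟩
    have : ((a ^ r - a : ℤ) : K) = ((r * c : ℤ) : K) := by rw [hc]
    push_cast at this
    simpa using this
  | add a b ha hb iha ihb =>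
    obtain ⟨z, hz, hz'⟩ := iha
    obtain ⟨w, hw, hw'⟩ := ihb
    obtain ⟨q, hq⟩ := exists_add_pow_prime_eq hr
      (⟨a, ha⟩ : Algebra.adjoin ℤ ({ζ} : Set K)) ⟨b, hb⟩
    have hq' := congrArg (Subtype.val) hq
    push_cast at hq'
    refine ⟨z + w + a * b * q, add_mem (add_mem hz hw) (mul_mem (mul_mem ha hb) q.2), ?_⟩
    rw [map_add]
    linear_combination hq' + hz' + hw'
  | mul a b ha hb iha ihb =>
    obtain ⟨z, hz, hz'⟩ := iha
    obtain ⟨w, hw, hw'⟩ := ihb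
    refine ⟨z * b ^ r + τ a * w, add_mem (mul_mem hz (pow_mem hb _))
      (mul_mem (hτmem a ha) hw), ?_⟩
    rw [map_mul, mul_pow]
    linear_combination b ^ r * hz' + τ a * hw'

theorem stmt_10 (n : ℕ) (hn : 1 < n) (s : ℕ+) (hs : 1 < (s : ℕ))
    (hcop : Nat.Coprime n s) (t : ℕ) (ht : t = orderOf (n : ZMod s))
    (hnt : Nat.Coprime n t)
    (ζ : CyclotomicField s ℚ) (hζ : IsPrimitiveRoot ζ s)
    (σ : CyclotomicField s ℚ ≃ₐ[ℚ] CyclotomicField s ℚ) (hσ : σ ζ = ζ ^ n)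
    (hdiv : ∀ r : ℕ, r.Prime → r ∣ n → ∃ i : ℕ, (r : ZMod s) = (n : ZMod s) ^ i) :
    ∃ f : (integralClosure ℤ (IntermediateField.fixedField (Subgroup.zpowers σ))) →+* ZMod n,
      Function.Surjective f := by
  have : NeZero (s : ℕ) := ⟨s.ne_zero⟩
  have : NeZero ((s : ℕ) : ℚ) := ⟨by exact_mod_cast s.ne_zero⟩
  have : IsDedekindDomain
      (integralClosure ℤ (IntermediateField.fixedField (Subgroup.zpowers σ))) :=
    integralClosure.isDedekindDomain ℤ ℚ _
  obtain ⟨f⟩ : Nonempty ((integralClosure ℤ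
      (IntermediateField.fixedField (Subgroup.zpowers σ))) →+* ZMod n) := by
    refine aux_global n (by omega) fun r hr hrn => ⟨?_, ?_⟩
    · intro hu
      have hl : IsLocalHom (algebraMap ℤ (integralClosure ℤ
          (IntermediateField.fixedField (Subgroup.zpowers σ)))) := inferInstance
      have : IsUnit (r : ℤ) := by
        refine hl.map_nonunit _ ?_
        simpa using hu
      exact (Nat.prime_iff_prime_int.1 hr).not_isUnit this
    · intro x
      obtain ⟨i, hi⟩ := hdiv r hr hrn
      have hpow : ∀ j : ℕ, (σ ^ j) ζ = ζ ^ (n ^ j) := by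
        intro j
        induction j with
        | zero => simp
        | succ j ih => rw [pow_succ', AlgEquiv.mul_apply, ih, map_pow, hσ, ← pow_mul, pow_succ']
      have hτ : (σ ^ i) ζ = ζ ^ r := by
        rw [hpow]
        have : n ^ i ≡ r [MOD s] := by
          rw [← ZMod.natCast_eq_natCast_iff]
          push_cast
          exact hi.symm
        rw [pow_eq_pow_mod (n ^ i) hζ.pow_eq_one, pow_eq_pow_mod r hζ.pow_eq_one, this]
      have hxint : IsIntegral ℤ ((x : IntermediateField.fixedField (Subgroup.zpowers σ)) :
          CyclotomicField s ℚ) := x.2.algebraMap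
      have : IsCyclotomicExtension {(s : ℕ)} ℚ (CyclotomicField s ℚ) := by
        convert CyclotomicField.isCyclotomicExtension (s : ℕ) ℚ
        · rfl
        · exact Subsingleton.elim _ _
      have : NumberField (CyclotomicField s ℚ) :=
        IsCyclotomicExtension.numberField {(s : ℕ)} ℚ _
      obtain ⟨z, hz, hz'⟩ := aux_frob (s : ℕ) ζ hζ r hr ((σ ^ i : CyclotomicField s ℚ ≃ₐ[ℚ] CyclotomicField s ℚ) : CyclotomicField s ℚ →+* CyclotomicField s ℚ) hτ _ hxint
      have hfix : (σ ^ i) ((x : IntermediateField.fixedField (Subgroup.zpowers σ)) :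
          CyclotomicField s ℚ) = x.1.1 :=
        x.1.2 ⟨σ ^ i, Subgroup.npow_mem_zpowers σ i⟩
      replace hz' : x.1.1 ^ r - (σ ^ i) x.1.1 = r * z := hz'
      rw [hfix] at hz'
      have hr0 : (r : CyclotomicField s ℚ) ≠ 0 := by exact_mod_cast hr.ne_zero
      have hzL : z ∈ IntermediateField.fixedField (Subgroup.zpowers σ) := by
        have : z = (x.1.1 ^ r - x.1.1) / r := by
          field_simp
          linear_combination -hz'
        rw [this]
        exact div_mem (sub_mem (pow_mem x.1.2 _) x.1.2) (natCast_mem _ r)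
      have hzint : IsIntegral ℤ
          (⟨z, hzL⟩ : IntermediateField.fixedField (Subgroup.zpowers σ)) := by
        rw [← isIntegral_algebraMap_iff (A := IntermediateField.fixedField (Subgroup.zpowers σ))
          (B := CyclotomicField s ℚ) (FaithfulSMul.algebraMap_injective _ _)]
        exact hz
      refine ⟨⟨⟨z, hzL⟩, hzint⟩, ?_⟩
      apply Subtype.ext
      apply Subtype.ext
      push_cast
      exact hz'
  exact ⟨f, ZMod.ringHom_surjective f⟩
end

section
/- Let n ≥ 2 be an integer, s > 1 a squarefree integer coprime to n, and t ≥ 1. Let R be a commutative ring with a ℤ/nℤ-algebra structure such that for every prime r dividing n the image of r in R is not a unit. Let σ be a ℤ/nℤ-algebra automorphism of R with σ^t = id, such that every element of R fixed by σ lies in the image of the structure map ℤ/nℤ → R. Let α be a unit of R with σ(α) = α^n. Suppose that for every prime q dividing s, q divides n^t − 1 and α^{(n^t−1)/q} − 1 is a unit of R. Then every divisor r of n satisfies r ≡ n^i (mod s) for some natural number i. -/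
open Polynomial in
theorem stmt_13_prime (n : ℕ) (s : ℕ) (hs : 1 < s)
    (t : ℕ)
    (R : Type*) [CommRing R] [Algebra (ZMod n) R]
    (σ : R ≃ₐ[ZMod n] R)
    (hfix : ∀ x : R, σ x = x → x ∈ Set.range (algebraMap (ZMod n) R))
    (β : R) (hσβ : σ β = β ^ n) (hβs : β ^ s = 1) (ht : 1 ≤ t) (hβt : β ^ n ^ t = β)
    (hq : ∀ q : ℕ, q.Prime → q ∣ s → IsUnit (β ^ (s / q) - 1))
    (r : ℕ) (hr : r.Prime) (hru : ¬ IsUnit (r : R)) :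
    ∃ i : ℕ, (r : ZMod s) = (n : ZMod s) ^ i := by
  obtain ⟨M, hM, hrM⟩ := exists_max_ideal_of_mem_nonunits (a := (r : R)) hru
  letI : Field (R ⧸ M) := Ideal.Quotient.field M
  let φ : R →+* R ⧸ M := Ideal.Quotient.mk M
  have hr0 : ((r : ℕ) : R ⧸ M) = 0 := by
    have : φ (r : R) = 0 := Ideal.Quotient.eq_zero_iff_mem.mpr hrM
    simpa using this
  haveI : Fact r.Prime := ⟨hr⟩
  haveI : CharP (R ⧸ M) r := by
    refine (CharP.charP_iff_prime_eq_zero hr).mpr hr0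
  have hord : orderOf (φ β) = s := by
    apply orderOf_eq_of_pow_and_pow_div_prime (by omega)
    · rw [← map_pow, hβs, map_one]
    · intro q hqp hqs h
      have := (hq q hqp hqs).map φ
      rw [map_sub, map_pow, h, map_one, sub_self] at this
      exact not_isUnit_zero this
  let f : R[X] := ∏ i ∈ Finset.range t, (X - C (β ^ n ^ i))
  have hf : f.map (σ : R →+* R) = f := by
    have h1 : f.map (σ : R →+* R) = ∏ i ∈ Finset.range t, (X - C (β ^ n ^ (i+1))) := by
      simp only [f, Polynomial.map_prod]
      refine Finset.prod_congr rfl fun i _ => ?_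
      simp [hσβ, pow_succ', pow_mul]
    rw [h1]
    obtain ⟨u, rfl⟩ : ∃ u, t = u + 1 := ⟨t - 1, by omega⟩
    simp only [f]
    rw [Finset.prod_range_succ, Finset.prod_range_succ' (fun i => X - C (β ^ n ^ i)), hβt]
    simp
  have hfr : (f.map φ).map (frobenius (R ⧸ M) r) = f.map φ := by
    ext k
    rw [coeff_map, coeff_map]
    have : σ (f.coeff k) = f.coeff k := by
      conv_rhs => rw [← hf]
      rw [coeff_map]; rfl
    obtain ⟨c, hc⟩ := hfix _ this
    obtain ⟨z, rfl⟩ := ZMod.intCast_surjective c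
    rw [← hc]
    simp
  have hroot : (f.map φ).eval (φ β) = 0 := by
    simp only [f, Polynomial.map_prod, eval_prod]
    apply Finset.prod_eq_zero (i := 0) (by simp; omega)
    simp
  have hroot2 : (f.map φ).eval (φ β ^ r) = 0 := by
    rw [← hfr, ← frobenius_def, eval_map_apply, hroot, map_zero]
  simp only [f, Polynomial.map_prod, eval_prod, Finset.prod_eq_zero_iff] at hroot2
  obtain ⟨i, -, hi⟩ := hroot2
  refine ⟨i, ?_⟩
  have h2 : φ β ^ r = φ β ^ n ^ i := by
    simpa [sub_eq_zero] using hi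
  have hfin : IsOfFinOrder (φ β) := by
    rw [← orderOf_pos_iff, hord]; omega
  rw [hfin.pow_eq_pow_iff_modEq, hord] at h2
  exact_mod_cast (ZMod.natCast_eq_natCast_iff _ _ _).mpr h2

theorem stmt_13 (n : ℕ) (hn : 2 ≤ n) (s : ℕ) (hs : 1 < s) (hsq : Squarefree s)
    (hcop : Nat.Coprime n s) (t : ℕ) (ht : 1 ≤ t)
    (R : Type*) [CommRing R] [Algebra (ZMod n) R]
    (hnonunit : ∀ r : ℕ, r.Prime → r ∣ n → ¬ IsUnit ((r : R)))
    (σ : R ≃ₐ[ZMod n] R) (hσt : σ ^ t = 1)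
    (hfix : ∀ x : R, σ x = x → x ∈ Set.range (algebraMap (ZMod n) R))
    (α : R) (hα : IsUnit α) (hσα : σ α = α ^ n)
    (hq : ∀ q : ℕ, q.Prime → q ∣ s →
      q ∣ n ^ t - 1 ∧ IsUnit (α ^ ((n ^ t - 1) / q) - 1)) :
    ∀ r : ℕ, r ∣ n → ∃ i : ℕ, (r : ZMod s) = (n : ZMod s) ^ i := by
  have hpow : ∀ k : ℕ, (σ ^ k) α = α ^ n ^ k := by
    intro k
    induction k with
    | zero => simp
    | succ k ih => rw [pow_succ', AlgEquiv.mul_apply, ih, map_pow, hσα, ← pow_mul, pow_succ']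
  have hαt : α ^ n ^ t = α := by rw [← hpow, hσt]; rfl
  have hnt : 1 ≤ n ^ t := Nat.one_le_pow _ _ (by omega)
  have hα1 : α ^ (n ^ t - 1) = 1 := by
    apply hα.mul_left_cancel
    rw [← pow_succ', Nat.sub_add_cancel hnt, hαt, mul_one]
  have hsN : s ∣ n ^ t - 1 := by
    rw [← Nat.prod_primeFactors_of_squarefree hsq]
    apply Finset.prod_primes_dvd
    · intro q h; exact (Nat.prime_of_mem_primeFactors h).prime
    · intro q h
      exact (hq q (Nat.prime_of_mem_primeFactors h) (Nat.dvd_of_mem_primeFactors h)).1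
  obtain ⟨m, hm⟩ := hsN
  have key : ∀ p : ℕ, p.Prime → p ∣ n → ∃ i : ℕ, (p : ZMod s) = (n : ZMod s) ^ i := by
    intro p hp hpn
    refine stmt_13_prime n s hs t R σ hfix (α ^ m) ?_ ?_ ht ?_ ?_ p hp (hnonunit p hp hpn)
    · rw [map_pow, hσα, pow_right_comm]
    · rw [← pow_mul, mul_comm, ← hm, hα1]
    · rw [pow_right_comm, hαt]
    · intro q hqp hqs
      have h := (hq q hqp hqs).2
      obtain ⟨u, rfl⟩ := hqs
      rw [hm, mul_assoc, Nat.mul_div_cancel_left _ hqp.pos] at h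
      rw [Nat.mul_div_cancel_left _ hqp.pos, ← pow_mul, mul_comm]
      exact h
  intro r
  induction r using Nat.recOnMul with
  | zero => intro h; have := Nat.eq_zero_of_zero_dvd h; omega
  | one => intro _; exact ⟨0, by simp⟩
  | prime p hp => exact key p hp
  | mul a b iha ihb =>
    intro h
    obtain ⟨i, hi⟩ := iha (dvd_of_mul_right_dvd h)
    obtain ⟨j, hj⟩ := ihb (dvd_of_mul_left_dvd h)
    exact ⟨i + j, by rw [Nat.cast_mul, hi, hj, pow_add]⟩
end

section
/- Let m ≥ 1 be an integer, let ν and x be units of ℤ/mℤ, and let ψ be an additive character of ℤ/mℤ with values in ℂ. Let d be the index of the cyclic subgroup ⟨ν⟩ in (ℤ/mℤ)ˣ. Then d · ∑_{μ ∈ x·⟨ν⟩} ψ(μ) = ∑_{χ} χ(x)^{−1} · τ(χ), where the sum on the right ranges over all multiplicative characters χ of ℤ/mℤ with values in ℂ satisfying χ(ν) = 1, and τ(χ) = ∑_{y ∈ ℤ/mℤ} χ(y)·ψ(y). -/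
theorem stmt_14 (m : ℕ) [NeZero m] (hm : 1 ≤ m) (ν x : (ZMod m)ˣ)
    (ψ : AddChar (ZMod m) ℂ) (d : ℕ) (hd : d = (Subgroup.zpowers ν).index)
    (S : Finset (MulChar (ZMod m) ℂ))
    (hS : ∀ χ : MulChar (ZMod m) ℂ, χ ∈ S ↔ χ ((ν : ZMod m)) = 1) :
    (d : ℂ) * (∑ σ : Subgroup.zpowers ν, ψ (((x * (σ : (ZMod m)ˣ)) : (ZMod m)ˣ) : ZMod m))
      = ∑ χ ∈ S, (χ ((x : ZMod m)))⁻¹ * gaussSum χ ψ := by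
  classical
  have key : ∀ χ : MulChar (ZMod m) ℂ,
      ∑ σ : Subgroup.zpowers ν, (χ ((σ : (ZMod m)ˣ) : ZMod m))⁻¹
        = if χ ∈ S then (Fintype.card (Subgroup.zpowers ν) : ℂ) else 0 := by
    intro χ
    split_ifs with h
    · rw [hS] at h
      have : ∀ σ : Subgroup.zpowers ν, (χ ((σ : (ZMod m)ˣ) : ZMod m))⁻¹ = 1 := by
        rintro ⟨σ, hσ⟩
        obtain ⟨k, rfl⟩ := (mem_powers_iff_mem_zpowers).2 hσ
        simp [h]
      simp [this]
    · rw [hS] at h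
      have e := Fintype.sum_equiv (Equiv.mulLeft (⟨ν, Subgroup.mem_zpowers ν⟩ : Subgroup.zpowers ν))
        (fun σ => (χ ((ν : (ZMod m)ˣ) : ZMod m))⁻¹ * (χ ((σ : (ZMod m)ˣ) : ZMod m))⁻¹)
        (fun σ => (χ ((σ : (ZMod m)ˣ) : ZMod m))⁻¹) (by intro σ; simp [mul_comm])
      rw [← Finset.mul_sum] at e
      by_contra h0
      apply h
      have := mul_right_cancel₀ h0 (e.trans (one_mul _).symm)
      simpa using this
  have hc : (Fintype.card (Subgroup.zpowers ν) : ℂ) ≠ 0 := by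
    exact_mod_cast Fintype.card_ne_zero
  have hcard : (m.totient : ℂ) = Fintype.card (Subgroup.zpowers ν) * d := by
    rw [hd, ← ZMod.card_units_eq_totient, ← Nat.card_eq_fintype_card, ← Nat.card_eq_fintype_card,
      ← Subgroup.card_mul_index (Subgroup.zpowers ν)]
    push_cast; rfl
  apply mul_left_cancel₀ hc
  rw [← mul_assoc, ← hcard]
  have hR : (Fintype.card (Subgroup.zpowers ν) : ℂ) * ∑ χ ∈ S, (χ ((x : ZMod m)))⁻¹ * gaussSum χ ψ
      = ∑ χ : MulChar (ZMod m) ℂ, ∑ σ : Subgroup.zpowers ν, ∑ y : ZMod m,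
        (χ ((σ : (ZMod m)ˣ) : ZMod m))⁻¹ * ((χ ((x : ZMod m)))⁻¹ * (χ y * ψ y)) := by
    simp_rw [← Finset.mul_sum, ← Finset.sum_mul, key, ite_mul, zero_mul, Finset.sum_ite_mem,
      Finset.univ_inter, Finset.mul_sum, gaussSum, Finset.mul_sum]
  rw [hR, Finset.sum_comm, Finset.mul_sum]
  refine Finset.sum_congr rfl fun σ _ => ?_
  rw [Finset.sum_comm]
  have hy : ∀ y : ZMod m, ∑ χ : MulChar (ZMod m) ℂ,
      (χ ((σ : (ZMod m)ˣ) : ZMod m))⁻¹ * ((χ ((x : ZMod m)))⁻¹ * (χ y * ψ y))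
      = (if ((x * (σ : (ZMod m)ˣ) : (ZMod m)ˣ) : ZMod m) = y then (m.totient : ℂ) else 0) * ψ y := by
    intro y
    rw [← DirichletCharacter.sum_char_inv_mul_char_eq ℂ (x * (σ : (ZMod m)ˣ)).isUnit y,
      Finset.sum_mul]
    refine Finset.sum_congr (by ext; simp) fun χ _ => ?_
    have h1 : χ (((x * (σ : (ZMod m)ˣ) : (ZMod m)ˣ) : ZMod m)⁻¹)
        * χ ((x * (σ : (ZMod m)ˣ) : (ZMod m)ˣ) : ZMod m) = 1 := by
      rw [← map_mul, ZMod.inv_mul_of_unit _ (Units.isUnit _), map_one]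
    rw [eq_inv_of_mul_eq_one_left h1, Units.val_mul, map_mul, mul_inv]
    ring
  simp_rw [hy]
  simp
end

section
/- Let n > 2 and s > 1 be coprime integers with s² > n, and let t be the multiplicative order of n modulo s. Let A be a commutative ring equipped with a ℤ/nℤ-algebra structure such that for every prime r dividing n the image of r in A is not a unit. Suppose α is a unit of A with Φ_s(α) = 0 in A, every coefficient of the polynomial ∏_{i=1}^{t} (X − α^{n^i}) ∈ A[X] lies in the image of the structure map ℤ/nℤ → A, and for every 1 ≤ i ≤ t the residue r_i = n^i mod s (represented in [0, s)) satisfies: if r_i divides n then r_i = 1 or r_i = n. Then n is prime. -/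
theorem stmt_19 (n s : ℕ) (hn : 2 < n) (hs : 1 < s) (hcop : Nat.Coprime n s)
    (hs2 : n < s ^ 2)
    (t : ℕ) (ht : t = orderOf (n : ZMod s))
    (A : Type*) [CommRing A] [Algebra (ZMod n) A]
    (hnonunit : ∀ r : ℕ, r.Prime → r ∣ n → ¬ IsUnit ((r : A)))
    (α : A) (hα : IsUnit α)
    (hΦ : Polynomial.eval α (Polynomial.cyclotomic s A) = 0)
    (hΨ : ∀ j : ℕ,
      (∏ i ∈ Finset.range t, (Polynomial.X - Polynomial.C (α ^ n ^ (i + 1)))).coeff j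
        ∈ Set.range (algebraMap (ZMod n) A))
    (hres : ∀ i : ℕ, 1 ≤ i → i ≤ t → (n ^ i % s) ∣ n → n ^ i % s = 1 ∨ n ^ i % s = n) :
    Nat.Prime n := by
  by_contra hnp
  have hr : (n.minFac).Prime := Nat.minFac_prime (by omega)
  have hrn : n.minFac ∣ n := Nat.minFac_dvd n
  have hsq : n.minFac ^ 2 ≤ n := Nat.minFac_sq_le_self (by omega) hnp
  have hne : n.minFac ≠ n := fun h => hnp (h ▸ hr)
  generalize n.minFac = r at hr hrn hsq hne
  have hrs : r < s := lt_of_pow_lt_pow_left₀ 2 (by omega) (lt_of_le_of_lt hsq hs2)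
  obtain ⟨m, hm, hrm⟩ := exists_max_ideal_of_mem_nonunits (hnonunit r hr hrn)
  have : NeZero s := ⟨by omega⟩
  have : NeZero n := ⟨by omega⟩
  let : Field (A ⧸ m) := Ideal.Quotient.field m
  set π : A →+* A ⧸ m := Ideal.Quotient.mk m with hπ
  have hr0 : (r : A ⧸ m) = 0 := by
    rw [← map_natCast π]
    exact Ideal.Quotient.eq_zero_iff_mem.mpr hrm
  have : Fact r.Prime := ⟨hr⟩
  have : CharP (A ⧸ m) r := (CharP.charP_iff_prime_eq_zero hr).mpr hr0
  have : NeZero (s : A ⧸ m) := ⟨fun h => by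
    have h1 := (CharP.cast_eq_zero_iff (A ⧸ m) r s).mp h
    exact hr.one_lt.ne' (Nat.eq_one_of_dvd_coprimes hcop hrn h1)⟩
  have hprim : IsPrimitiveRoot (π α) s := by
    rw [← Polynomial.isRoot_cyclotomic_iff, Polynomial.IsRoot.def,
      ← Polynomial.map_cyclotomic s π, Polynomial.eval_map_apply, hΦ, map_zero]
  have hfin : IsOfFinOrder (π α) :=
    isOfFinOrder_iff_pow_eq_one.mpr ⟨s, by omega, hprim.pow_eq_one⟩
  have htpos : 0 < t := by
    rw [ht, ← ZMod.coe_unitOfCoprime n hcop, orderOf_units]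
    exact orderOf_pos _
  set P := ∏ i ∈ Finset.range t, (Polynomial.X - Polynomial.C (α ^ n ^ (i + 1))) with hP
  have hfix : (P.map π).map (frobenius (A ⧸ m) r) = P.map π := by
    ext j
    rw [Polynomial.coeff_map, Polynomial.coeff_map]
    obtain ⟨z, hz⟩ := hΨ j
    rw [← hz, ← ZMod.natCast_zmod_val z]
    simp only [map_natCast]
  have hev : ∀ x, (P.map π).eval x
      = ∏ i ∈ Finset.range t, (x - (π α) ^ n ^ (i + 1)) := by
    intro x
    simp [hP, Polynomial.map_prod, Polynomial.eval_prod]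
  have hone : n ^ t ≡ 1 [MOD s] := by
    rw [← ZMod.natCast_eq_natCast_iff]
    push_cast
    rw [ht, pow_orderOf_eq_one]
  have h0 : (P.map π).eval (π α) = 0 := by
    rw [hev]
    refine Finset.prod_eq_zero (i := t - 1) (by simp; omega) ?_
    rw [Nat.sub_add_cancel htpos, sub_eq_zero]
    have := (hfin.pow_eq_pow_iff_modEq (n := n ^ t) (m := 1)).mpr
      (hprim.eq_orderOf ▸ hone)
    rw [this, pow_one]
  have h1 : (P.map π).eval ((π α) ^ r) = 0 := by
    rw [← hfix, ← frobenius_def, Polynomial.eval_map_apply, h0, map_zero]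
  rw [hev, Finset.prod_eq_zero_iff] at h1
  obtain ⟨i, hi, h2⟩ := h1
  rw [sub_eq_zero, hfin.pow_eq_pow_iff_modEq, ← hprim.eq_orderOf] at h2
  have h3 : n ^ (i + 1) % s = r := by
    rw [← h2, Nat.mod_eq_of_lt hrs]
  rcases hres (i + 1) (by omega) (by simpa using hi) (h3 ▸ hrn) with h | h
  · exact hr.one_lt.ne' (h3 ▸ h)
  · exact hne (h3 ▸ h)
end
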